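/- Let A ∈ ℝ^{n×m} have rank r with 1 ≤ r ≤ min(n,m), and let A = U Vᵀ be a rank-revealing factorization, i.e. U ∈ ℝ^{n×r} and V ∈ ℝ^{m×r} both have full column rank r. Then for any B ∈ ℝ^{n×m}, C_r(B) = C_r(A) if and only if there exists T ∈ ℝ^{r×r} with det(T) = 1 such that B = U T Vᵀ. -/

import Mathlib

open Matrix

/-- The `k`-th multiplicative compound of a matrix `A : ℝ^{n×m}`. -/
def compound {n m : ℕ} (k : ℕ) (A : Matrix (Fin n) (Fin m) ℝ) :
    Matrix {s : Finset (Fin n) // s.card = k} {t : Finset (Fin m) // t.card = k} ℝ :=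
  fun I J => Matrix.det (Matrix.of fun a b : Fin k =>
    A (I.1.orderEmbOfFin I.2 a) (J.1.orderEmbOfFin J.2 b))

lemma exists_perm_orderEmb {n r : ℕ} (f : Fin r → Fin n) (hf : Function.Injective f) :
    ∃ (s : Finset (Fin n)) (hs : s.card = r) (σ : Equiv.Perm (Fin r)),
      f = (s.orderEmbOfFin hs) ∘ σ := by
  classical
  have hs : (Finset.univ.image f).card = r := by
    rw [Finset.card_image_of_injective _ hf]; simp
  have hmem : ∀ i, f i ∈ Finset.univ.image f := fun i => by simp
  refine ⟨Finset.univ.image f, hs, Equiv.ofBijective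
    (fun i => ((Finset.univ.image f).orderIsoOfFin hs).symm ⟨f i, hmem i⟩) ?_, ?_⟩
  · rw [← Finite.injective_iff_bijective]
    intro a b hab
    have := (OrderIso.injective _) hab
    exact hf (Subtype.ext_iff.1 this)
  · funext i
    simp only [Function.comp, Equiv.ofBijective_apply, ← Finset.coe_orderIsoOfFin_apply,
      OrderIso.apply_symm_apply]

lemma minors_eq {n m r : ℕ} {A B : Matrix (Fin n) (Fin m) ℝ} (h : compound r B = compound r A)
    (f : Fin r → Fin n) (g : Fin r → Fin m) :
    (B.submatrix f g).det = (A.submatrix f g).det := by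
  by_cases hf : Function.Injective f
  · by_cases hg : Function.Injective g
    · obtain ⟨s, hs, σ, rfl⟩ := exists_perm_orderEmb f hf
      obtain ⟨t, ht, τ, rfl⟩ := exists_perm_orderEmb g hg
      have key : ∀ M : Matrix (Fin n) (Fin m) ℝ,
          (M.submatrix (s.orderEmbOfFin hs ∘ σ) (t.orderEmbOfFin ht ∘ τ)).det =
          Equiv.Perm.sign σ * (Equiv.Perm.sign τ * compound r M ⟨s, hs⟩ ⟨t, ht⟩) := by
        intro M
        have h1 : M.submatrix (s.orderEmbOfFin hs ∘ σ) (t.orderEmbOfFin ht ∘ τ) =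
          ((M.submatrix (s.orderEmbOfFin hs) (t.orderEmbOfFin ht)).submatrix id τ).submatrix
            σ id := rfl
        rw [h1, det_permute, det_permute']
        rfl
      rw [key, key, h]
    · simp only [Function.Injective, not_forall] at hg
      obtain ⟨a, b, hab, hne⟩ := hg
      rw [det_zero_of_column_eq hne, det_zero_of_column_eq hne] <;> simp [hab]
  · simp only [Function.Injective, not_forall] at hf
    obtain ⟨a, b, hab, hne⟩ := hf
    rw [det_zero_of_row_eq hne, det_zero_of_row_eq hne] <;> ext <;> simp [hab]

lemma mul_adjugate_minor {n r : ℕ} (P : Matrix (Fin n) (Fin r) ℝ) (I : Fin r → Fin n)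
    (i : Fin n) (k : Fin r) :
    (P * (P.submatrix I id).adjugate) i k =
      (P.submatrix (Function.update I k i) id).det := by
  have h1 : (P * (P.submatrix I id).adjugate) i k =
      cramer (P.submatrix I id)ᵀ (P i) k := by
    rw [cramer_eq_adjugate_mulVec, ← adjugate_transpose, mulVec_transpose]
    rfl
  rw [h1, cramer_transpose_apply]
  congr 1
  ext a b
  by_cases hk : a = k
  · subst hk; simp
  · simp [hk, updateRow_ne]

lemma mul_inv_minor {n r : ℕ} (P Q : Matrix (Fin n) (Fin r) ℝ)
    (h : ∀ f : Fin r → Fin n, (P.submatrix f id).det = (Q.submatrix f id).det)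
    (I : Fin r → Fin n) :
    P * (P.submatrix I id)⁻¹ = Q * (Q.submatrix I id)⁻¹ := by
  rw [inv_def, inv_def, Matrix.mul_smul, Matrix.mul_smul, h I]
  congr 1
  ext i k
  rw [mul_adjugate_minor, mul_adjugate_minor, h]

lemma exists_minor {n r : ℕ} (U : Matrix (Fin n) (Fin r) ℝ) (hU : U.rank = r) :
    ∃ I : Fin r → Fin n, IsUnit (U.submatrix I id).det := by
  rw [rank_eq_finrank_span_row] at hU
  obtain ⟨f, hf, -, hli⟩ := Submodule.exists_fun_fin_finrank_span_eq ℝ (Set.range U.row)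
  choose I hI using hf
  refine ⟨I ∘ Fin.cast hU.symm, ?_⟩
  rw [← isUnit_iff_isUnit_det, ← linearIndependent_rows_iff_isUnit]
  have : (U.submatrix (I ∘ Fin.cast hU.symm) id).row = f ∘ Fin.cast hU.symm := by
    funext a
    exact hI _
  rw [this]
  exact hli.comp _ (Fin.cast_injective _)

lemma big_minor {n m r : ℕ} (hr1 : 1 ≤ r) (A B : Matrix (Fin n) (Fin m) ℝ) (hr : A.rank = r)
    (h : ∀ (f : Fin r → Fin n) (g : Fin r → Fin m),
      (B.submatrix f g).det = (A.submatrix f g).det)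
    (f : Fin (r + 1) → Fin n) (g : Fin (r + 1) → Fin m) : (B.submatrix f g).det = 0 := by
  have hA : (A.submatrix f g).det = 0 := by
    by_contra hne
    have h1 := rank_of_isUnit _ ((isUnit_iff_isUnit_det _).2 (isUnit_iff_ne_zero.2 hne))
    have h2 := rank_submatrix_le A f g
    simp at h1
    omega
  have hadj : (B.submatrix f g).adjugate = (A.submatrix f g).adjugate := by
    ext i j
    rw [adjugate_fin_succ_eq_det_submatrix, adjugate_fin_succ_eq_det_submatrix,
      submatrix_submatrix, submatrix_submatrix, h]
  have h3 := congrArg det hadj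
  rw [det_adjugate, det_adjugate, hA] at h3
  simp only [Fintype.card_fin, Nat.add_sub_cancel] at h3
  rw [zero_pow (by omega)] at h3
  exact eq_zero_of_pow_eq_zero h3

lemma skeleton {n m r : ℕ} (B : Matrix (Fin n) (Fin m) ℝ)
    (h : ∀ (f : Fin (r + 1) → Fin n) (g : Fin (r + 1) → Fin m), (B.submatrix f g).det = 0)
    (I : Fin r → Fin n) (J : Fin r → Fin m) (hI : IsUnit (B.submatrix I J).det) :
    B = B.submatrix id J * (B.submatrix I J)⁻¹ * B.submatrix I id := by
  ext i j
  have h1 := h (Sum.elim I (fun _ : Fin 1 => i) ∘ finSumFinEquiv.symm)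
    (Sum.elim J (fun _ : Fin 1 => j) ∘ finSumFinEquiv.symm)
  rw [← submatrix_submatrix, det_submatrix_equiv_self] at h1
  have h2 : B.submatrix (Sum.elim I (fun _ : Fin 1 => i)) (Sum.elim J (fun _ : Fin 1 => j)) =
      fromBlocks (B.submatrix I J) (B.submatrix I (fun _ => j))
        (B.submatrix (fun _ => i) J) (B.submatrix (fun _ => i) (fun _ => j)) := by
    ext a b
    rcases a with a | a <;> rcases b with b | b <;> rfl
  letI := invertibleOfIsUnitDet _ hI
  rw [h2, det_fromBlocks₁₁, mul_eq_zero, or_iff_right hI.ne_zero, det_fin_one, Matrix.sub_apply,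
    sub_eq_zero, invOf_eq_nonsing_inv] at h1
  exact h1

/-- If `A` has rank `r` with `1 ≤ r ≤ min(n,m)` and `A = U Vᵀ` is a rank-revealing
factorization (`U`, `V` of full column rank `r`), then `C_r(B) = C_r(A)` iff
`B = U T Vᵀ` for some `T` with `det T = 1`. -/
theorem stmt_2 {n m r : ℕ} (A : Matrix (Fin n) (Fin m) ℝ)
    (hr : A.rank = r) (hr1 : 1 ≤ r) (hrn : r ≤ n) (hrm : r ≤ m)
    (U : Matrix (Fin n) (Fin r) ℝ) (V : Matrix (Fin m) (Fin r) ℝ)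
    (hU : U.rank = r) (hV : V.rank = r) (hA : A = U * Vᵀ)
    (B : Matrix (Fin n) (Fin m) ℝ) :
    compound r B = compound r A ↔
      ∃ T : Matrix (Fin r) (Fin r) ℝ, T.det = 1 ∧ B = U * T * Vᵀ := by
  constructor
  · intro hc
    have hm := minors_eq hc
    obtain ⟨I, hI⟩ := exists_minor U hU
    obtain ⟨J, hJ⟩ := exists_minor V hV
    have hJ' : IsUnit ((V.submatrix J id)ᵀ).det := by rwa [det_transpose]
    have hAIJ : A.submatrix I J = U.submatrix I id * (V.submatrix J id)ᵀ := by
      rw [hA]; rfl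
    have hdet : (B.submatrix I J).det = (U.submatrix I id).det * ((V.submatrix J id)ᵀ).det := by
      rw [hm, hAIJ, det_mul]
    have hB : IsUnit (B.submatrix I J).det := by rw [hdet]; exact hI.mul hJ'
    have hsk := skeleton B (big_minor hr1 A B hr hm) I J hB
    have e1 : B.submatrix id J * (B.submatrix I J)⁻¹ = U * (U.submatrix I id)⁻¹ := by
      have := mul_inv_minor (B.submatrix id J) (A.submatrix id J) (fun f => hm f J) I
      have hq : A.submatrix id J = U * (V.submatrix J id)ᵀ := by rw [hA]; rfl
      change B.submatrix id J * (B.submatrix I J)⁻¹ = A.submatrix id J * (A.submatrix I J)⁻¹ at this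
      rw [this, hAIJ, hq, Matrix.mul_inv_rev, Matrix.mul_assoc,
        Matrix.mul_nonsing_inv_cancel_left _ _ hJ']
    have e2 : (B.submatrix I J)⁻¹ * B.submatrix I id = ((V.submatrix J id)ᵀ)⁻¹ * Vᵀ := by
      have := mul_inv_minor (B.submatrix I id)ᵀ (A.submatrix I id)ᵀ (fun f => by
        have := hm I f
        rw [← det_transpose, ← det_transpose (A.submatrix I f)] at this
        exact this) J
      have hq : A.submatrix I id = U.submatrix I id * Vᵀ := by rw [hA]; rfl
      change (B.submatrix I id)ᵀ * ((B.submatrix I J)ᵀ)⁻¹ =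
        (A.submatrix I id)ᵀ * ((A.submatrix I J)ᵀ)⁻¹ at this
      rw [← transpose_nonsing_inv, ← transpose_nonsing_inv, ← transpose_mul, ← transpose_mul] at this
      rw [transpose_injective this, hAIJ, hq, Matrix.mul_inv_rev, Matrix.mul_assoc,
        Matrix.nonsing_inv_mul_cancel_left _ _ hI]
    refine ⟨(U.submatrix I id)⁻¹ * B.submatrix I J * ((V.submatrix J id)ᵀ)⁻¹, ?_, ?_⟩
    · rw [det_mul, det_mul, det_nonsing_inv, det_nonsing_inv, hdet, ← mul_assoc,
        Ring.inverse_mul_cancel _ hI, one_mul, Ring.mul_inverse_cancel _ hJ']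
    · calc B = B.submatrix id J * (B.submatrix I J)⁻¹ * B.submatrix I id := hsk
        _ = (B.submatrix id J * (B.submatrix I J)⁻¹) * B.submatrix I J *
              ((B.submatrix I J)⁻¹ * B.submatrix I id) := by
            simp only [Matrix.mul_assoc]
            rw [Matrix.mul_nonsing_inv_cancel_left _ _ hB]
        _ = _ := by
            rw [e1, e2]
            simp only [Matrix.mul_assoc]
  · rintro ⟨T, hT, rfl⟩
    ext I J
    have h1 : compound r (U * T * Vᵀ) I J = ((U.submatrix (I.1.orderEmbOfFin I.2) id) * T *
      (V.submatrix (J.1.orderEmbOfFin J.2) id)ᵀ).det := rfl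
    have h2 : compound r (U * Vᵀ) I J = ((U.submatrix (I.1.orderEmbOfFin I.2) id) *
      (V.submatrix (J.1.orderEmbOfFin J.2) id)ᵀ).det := rfl
    rw [hA, h1, h2, det_mul, det_mul, det_mul, hT, mul_one]
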